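/- Let X be a semi-inner product space, let γ₁, γ₂ > 0 with γ₁γ₂ < 1, and let G, Φ be relations on X such that ‖η‖ ≤ γ₁‖ξ‖ for every (ξ,η) ∈ G and ‖η‖ ≤ γ₂‖ξ‖ for every (ξ,η) ∈ Φ. Then there exists γ > 0 (depending only on γ₁ and γ₂) such that every ((u₁,u₂),(y₁,y₂)) ∈ R_uy satisfies ‖(y₁,y₂)‖ ≤ γ‖(u₁,u₂)‖. -/

import Mathlib

/-- A semi-inner product on a real vector space: a symmetric bilinear form
with nonnegative diagonal. -/
structure SIP (X : Type*) [AddCommGroup X] [Module ℝ X] where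
  ip : X → X → ℝ
  symm : ∀ x y, ip x y = ip y x
  add_left : ∀ x y z, ip (x + y) z = ip x z + ip y z
  smul_left : ∀ (a : ℝ) (x y : X), ip (a • x) y = a * ip x y
  nonneg : ∀ x, 0 ≤ ip x x

variable {X : Type*} [AddCommGroup X] [Module ℝ X]

/-- Quadratic form `Q_P(ξ₁,ξ₂) = P₁₁⟨ξ₁,ξ₁⟩ + 2P₁₂⟨ξ₁,ξ₂⟩ + P₂₂⟨ξ₂,ξ₂⟩`. -/
def SIP.Q (s : SIP X) (P : Matrix (Fin 2) (Fin 2) ℝ) (ξ₁ ξ₂ : X) : ℝ :=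
  P 0 0 * s.ip ξ₁ ξ₁ + 2 * P 0 1 * s.ip ξ₁ ξ₂ + P 1 1 * s.ip ξ₂ ξ₂

/-- Semi-norm of a pair: `‖(a,b)‖ = √(⟨a,a⟩ + ⟨b,b⟩)`. -/
noncomputable def SIP.pairNorm (s : SIP X) (p : X × X) : ℝ :=
  Real.sqrt (s.ip p.1 p.1 + s.ip p.2 p.2)

/-- `(u₁,u₂,e₁,e₂,y₁,y₂)` solves the interconnection of `G` and `Φ`. -/
def Solves (G Φ : Set (X × X)) (u₁ u₂ e₁ e₂ y₁ y₂ : X) : Prop :=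
  e₁ = u₁ + y₂ ∧ (e₂, y₂) ∈ Φ ∧ e₂ = u₂ + y₁ ∧ (e₁, y₁) ∈ G

/-- The closed-loop relation from inputs `(u₁,u₂)` to outputs `(y₁,y₂)`. -/
def Ruy (G Φ : Set (X × X)) : Set ((X × X) × (X × X)) :=
  {p | ∃ e₁ e₂ : X, Solves G Φ p.1.1 p.1.2 e₁ e₂ p.2.1 p.2.2}

/-- The closed-loop relation from inputs `(u₁,u₂)` to errors `(e₁,e₂)`. -/
def Rue (G Φ : Set (X × X)) : Set ((X × X) × (X × X)) :=
  {p | ∃ y₁ y₂ : X, Solves G Φ p.1.1 p.1.2 p.2.1 p.2.2 y₁ y₂}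

/-- A set of relations is complete if every pair is contained in some member. -/
def RelComplete (C : Set (Set (X × X))) : Prop :=
  ∀ x y : X, ∃ Φ ∈ C, (x, y) ∈ Φ

/-- Component of a pair, indexed by `Fin 2`. -/
def pcomp (p : X × X) (i : Fin 2) : X := if i = 0 then p.1 else p.2

/-- A set of relations is feedback-invariant if every partial closed-loop map
of members is again a member. -/
def FeedbackInvariant (C : Set (Set (X × X))) : Prop :=
  ∀ G ∈ C, ∀ Φ ∈ C, ∀ i j : Fin 2,
    {q : X × X | ∃ p ∈ Ruy G Φ, q.1 = pcomp p.1 i ∧ q.2 = pcomp p.2 j} ∈ C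

/-- Semi-norm induced by the semi-inner product. -/
noncomputable def SIP.pnorm (s : SIP X) (x : X) : ℝ := Real.sqrt (s.ip x x)

namespace SIP

theorem ip_smul_add_self (s : SIP X) (t : ℝ) (x y : X) :
    s.ip (t • x + y) (t • x + y) = s.ip x x * (t * t) + 2 * s.ip x y * t + s.ip y y := by
  rw [s.add_left, s.smul_left, s.symm x (t • x + y), s.symm y (t • x + y), s.add_left,
    s.add_left, s.smul_left, s.smul_left, s.symm y x]
  ring

theorem ip_sq_le (s : SIP X) (x y : X) : s.ip x y ^ 2 ≤ s.ip x x * s.ip y y := by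
  have h : discrim (s.ip x x) (2 * s.ip x y) (s.ip y y) ≤ 0 :=
    discrim_le_zero fun t => (s.nonneg (t • x + y)).trans_eq (s.ip_smul_add_self t x y)
  rw [discrim] at h
  linarith

theorem pnorm_nonneg (s : SIP X) (x : X) : 0 ≤ s.pnorm x := Real.sqrt_nonneg _

theorem pnorm_sq (s : SIP X) (x : X) : s.pnorm x ^ 2 = s.ip x x := Real.sq_sqrt (s.nonneg x)

theorem ip_le_pnorm_mul_pnorm (s : SIP X) (x y : X) : s.ip x y ≤ s.pnorm x * s.pnorm y := by
  refine le_of_abs_le (abs_le_of_sq_le_sq ?_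
    (mul_nonneg (s.pnorm_nonneg x) (s.pnorm_nonneg y)))
  rw [mul_pow, s.pnorm_sq, s.pnorm_sq]
  exact s.ip_sq_le x y

theorem pnorm_add_le (s : SIP X) (x y : X) : s.pnorm (x + y) ≤ s.pnorm x + s.pnorm y := by
  refine Real.sqrt_le_iff.mpr ⟨add_nonneg (s.pnorm_nonneg x) (s.pnorm_nonneg y), ?_⟩
  have h := s.ip_smul_add_self 1 x y
  rw [one_smul] at h
  linarith [s.ip_le_pnorm_mul_pnorm x y, s.pnorm_sq x, s.pnorm_sq y,
    add_sq (s.pnorm x) (s.pnorm y)]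

theorem pnorm_fst_le_pairNorm (s : SIP X) (p : X × X) : s.pnorm p.1 ≤ s.pairNorm p :=
  Real.sqrt_le_sqrt (le_add_of_nonneg_right (s.nonneg p.2))

theorem pnorm_snd_le_pairNorm (s : SIP X) (p : X × X) : s.pnorm p.2 ≤ s.pairNorm p :=
  Real.sqrt_le_sqrt (le_add_of_nonneg_left (s.nonneg p.1))

theorem pairNorm_le_add (s : SIP X) (p : X × X) : s.pairNorm p ≤ s.pnorm p.1 + s.pnorm p.2 := by
  refine Real.sqrt_le_iff.mpr ⟨add_nonneg (s.pnorm_nonneg p.1) (s.pnorm_nonneg p.2), ?_⟩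
  rw [← s.pnorm_sq, ← s.pnorm_sq]
  linarith [add_sq (s.pnorm p.1) (s.pnorm p.2),
    mul_nonneg (s.pnorm_nonneg p.1) (s.pnorm_nonneg p.2)]

end SIP

/-- small-gain theorem in a semi-inner product space:
if `γ₁γ₂ < 1` then there is a closed-loop gain `γ > 0`, depending only on
`γ₁` and `γ₂`, valid for all relations `G`, `Φ` with gains `γ₁`, `γ₂`. -/
theorem small_gain (s : SIP X) (γ₁ γ₂ : ℝ) (hγ₁ : 0 < γ₁) (hγ₂ : 0 < γ₂)
    (hsg : γ₁ * γ₂ < 1) :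
    ∃ γ : ℝ, 0 < γ ∧ ∀ G Φ : Set (X × X),
      (∀ ξ η : X, (ξ, η) ∈ G → s.pnorm η ≤ γ₁ * s.pnorm ξ) →
      (∀ ξ η : X, (ξ, η) ∈ Φ → s.pnorm η ≤ γ₂ * s.pnorm ξ) →
      ∀ u y : X × X, (u, y) ∈ Ruy G Φ → s.pairNorm y ≤ γ * s.pairNorm u := by
  have hδ : 0 < 1 - γ₁ * γ₂ := sub_pos.mpr hsg
  refine ⟨(γ₁ + γ₂ + 2 * (γ₁ * γ₂)) / (1 - γ₁ * γ₂), by positivity, ?_⟩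
  rintro G Φ hG hΦ u y ⟨e₁, e₂, rfl, he₂, rfl, he₁⟩
  have hy₁ : s.pnorm y.1 ≤ γ₁ * (s.pairNorm u + s.pnorm y.2) :=
    (hG _ _ he₁).trans <| mul_le_mul_of_nonneg_left ((s.pnorm_add_le _ _).trans
      (add_le_add_left (s.pnorm_fst_le_pairNorm u) _)) hγ₁.le
  have hy₂ : s.pnorm y.2 ≤ γ₂ * (s.pairNorm u + s.pnorm y.1) :=
    (hΦ _ _ he₂).trans <| mul_le_mul_of_nonneg_left ((s.pnorm_add_le _ _).trans
      (add_le_add_left (s.pnorm_snd_le_pairNorm u) _)) hγ₂.le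
  refine (s.pairNorm_le_add y).trans ?_
  rw [div_mul_eq_mul_div, le_div_iff₀ hδ]
  linarith [mul_le_mul_of_nonneg_left hy₁ hγ₂.le, mul_le_mul_of_nonneg_left hy₂ hγ₁.le]
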